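/- arXiv:2002.06157 — 4 statements merged into one kernel-verified Lean document; each statement's English description precedes it below -/
import Mathlib

section
/- In the GNN computation-tree setting, let (W₁,W₂) and (W₁′,W₂′) be two pairs of r×r matrices with spectral norms at most B₁ and B₂ respectively. Then the root-embedding difference Δ_L := ‖T_L(W₁,W₂) − T_L(W₁′,W₂′)‖₂ satisfies the recursive bound Δ_L ≤ C_φ B_x ‖W₁ − W₁′‖₂ + C·d·max_{j ∈ C(x_L)} Δ_{L−1,j} + C_φ ‖(W₂ − W₂′) R(W₁,W₂,x_L)‖₂, where Δ_{L−1,j} := ‖T_{L−1,j}(W₁,W₂) − T_{L−1,j}(W₁′,W₂′)‖₂ is the corresponding difference at the j-th child subtree of the root, and C = C_ρ C_g C_φ B₂. -/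
open scoped BigOperators

noncomputable section

/-- Euclidean space `ℝ^r` with the `ℓ₂` norm. -/
abbrev Er (r : ℕ) : Type := EuclideanSpace ℝ (Fin r)

/-- GNN embeddings on the complete `d`-ary computation tree.  A node is
identified with the list of child choices leading to it from the root; the
first argument is the remaining depth (so the root of a depth-`L` tree is
`treeEmb … L []`).  The update is
`T_u = φ(W₁ x_u + W₂ ρ(Σ_{u' child of u} g(T_{u'})))`,
with the empty sum equal to `0` at the leaves. -/
def treeEmb {r d : ℕ} (φ ρ g : Er r → Er r) (x : List (Fin d) → Er r)
    (W₁ W₂ : Er r →L[ℝ] Er r) : ℕ → List (Fin d) → Er r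
  | 0, u => φ (W₁ (x u) + W₂ (ρ 0))
  | k + 1, u =>
      φ (W₁ (x u) + W₂ (ρ (∑ j : Fin d, g (treeEmb φ ρ g x W₁ W₂ k (u ++ [j])))))

end

/-- One update step: the change of `φ (W₁ x + W₂ y)` when the weights and the aggregate `y` change. -/
theorem norm_update_sub_le {E F G : Type*}
    [SeminormedAddCommGroup E] [NormedSpace ℝ E] [SeminormedAddCommGroup F] [NormedSpace ℝ F]
    [SeminormedAddCommGroup G] {φ : F → G} {C : ℝ} (hC : 0 ≤ C)
    (hφ : ∀ u v, ‖φ u - φ v‖ ≤ C * ‖u - v‖) (W₁ W₂ W₁' W₂' : E →L[ℝ] F) (x y y' : E) :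
    ‖φ (W₁ x + W₂ y) - φ (W₁' x + W₂' y')‖ ≤
      C * (‖W₁ - W₁'‖ * ‖x‖ + ‖W₂'‖ * ‖y - y'‖ + ‖(W₂ - W₂') y‖) := by
  refine (hφ _ _).trans (mul_le_mul_of_nonneg_left ?_ hC)
  have split : W₁ x + W₂ y - (W₁' x + W₂' y') =
      (W₁ - W₁') x + W₂' (y - y') + (W₂ - W₂') y := by
    simp only [sub_apply, map_sub]
    abel
  rw [split]
  exact norm_add₃_le.trans
    (add_le_add_left (add_le_add ((W₁ - W₁').le_opNorm x) (W₂'.le_opNorm _)) _)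

/-- A Lipschitz image of a sum of Lipschitz images changes by at most `Cρ * Cg` times the number of
summands times a common bound on the changes of the summands. -/
theorem norm_aggregate_sub_le {ι E F G : Type*} [Fintype ι] [SeminormedAddCommGroup E]
    [SeminormedAddCommGroup F] [SeminormedAddCommGroup G] {ρ : F → G} {g : E → F} {Cρ Cg M : ℝ}
    (hCρ : 0 ≤ Cρ) (hCg : 0 ≤ Cg) (hρ : ∀ u v, ‖ρ u - ρ v‖ ≤ Cρ * ‖u - v‖)
    (hg : ∀ u v, ‖g u - g v‖ ≤ Cg * ‖u - v‖) {s t : ι → E} (hM : ∀ j, ‖s j - t j‖ ≤ M) :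
    ‖ρ (∑ j, g (s j)) - ρ (∑ j, g (t j))‖ ≤ Cρ * (Fintype.card ι * (Cg * M)) := by
  refine (hρ _ _).trans (mul_le_mul_of_nonneg_left ?_ hCρ)
  rw [← Finset.sum_sub_distrib, ← nsmul_eq_mul]
  exact norm_sum_le_of_le Finset.univ
    (fun j _ => (hg _ _).trans (mul_le_mul_of_nonneg_left (hM j) hCg)) |>.trans_eq (by simp)

/-- **Lemma 1 of the paper.** Recursive bound on the change of the
root embedding under a change of the shared weights:
`Δ_L ≤ C_φ B_x ‖W₁ − W₁'‖₂ + (C_ρ C_g C_φ B₂) d max_j Δ_{L−1,j}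
     + C_φ ‖(W₂ − W₂') R(W₁,W₂,x_L)‖₂`. -/
theorem treeEmb_weight_change_recursive_bound
    (r d L : ℕ) (hr : 1 ≤ r) (hd : 1 ≤ d) (hL : 1 ≤ L)
    (Bx B₁ B₂ b Cφ Cρ Cg : ℝ)
    (hBx : 0 < Bx) (hB₁ : 0 < B₁) (hB₂ : 0 < B₂) (hb : 0 < b)
    (hCφ : 0 < Cφ) (hCρ : 0 < Cρ) (hCg : 0 < Cg)
    (φ ρ g : Er r → Er r)
    (hφ : ∀ u v, ‖φ u - φ v‖ ≤ Cφ * ‖u - v‖)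
    (hρ : ∀ u v, ‖ρ u - ρ v‖ ≤ Cρ * ‖u - v‖)
    (hg : ∀ u v, ‖g u - g v‖ ≤ Cg * ‖u - v‖)
    (hφ0 : φ 0 = 0) (hρ0 : ρ 0 = 0) (hg0 : g 0 = 0)
    (hφb : ∀ u (i : Fin r), |φ u i| ≤ b)
    (x : List (Fin d) → Er r) (hx : ∀ u, ‖x u‖ ≤ Bx)
    (W₁ W₂ W₁' W₂' : Er r →L[ℝ] Er r)
    (hW₁ : ‖W₁‖ ≤ B₁) (hW₂ : ‖W₂‖ ≤ B₂) (hW₁' : ‖W₁'‖ ≤ B₁) (hW₂' : ‖W₂'‖ ≤ B₂) :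
    ‖treeEmb φ ρ g x W₁ W₂ L [] - treeEmb φ ρ g x W₁' W₂' L []‖ ≤
      Cφ * Bx * ‖W₁ - W₁'‖ +
      (Cρ * Cg * Cφ * B₂) * d *
        (Finset.univ.sup' ⟨⟨0, hd⟩, Finset.mem_univ _⟩ fun j : Fin d =>
          ‖treeEmb φ ρ g x W₁ W₂ (L - 1) [j] -
            treeEmb φ ρ g x W₁' W₂' (L - 1) [j]‖) +
      Cφ * ‖(W₂ - W₂')
        (ρ (∑ j : Fin d, g (treeEmb φ ρ g x W₁ W₂ (L - 1) [j])))‖ := by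
  obtain ⟨k, rfl⟩ : ∃ k, L = k + 1 := ⟨L - 1, by omega⟩
  simp only [treeEmb, Nat.add_sub_cancel, List.nil_append]
  set M := Finset.univ.sup' (⟨⟨0, hd⟩, Finset.mem_univ _⟩ : Finset.univ.Nonempty) fun j : Fin d =>
    ‖treeEmb φ ρ g x W₁ W₂ k [j] - treeEmb φ ρ g x W₁' W₂' k [j]‖
  have hR := norm_aggregate_sub_le hCρ.le hCg.le hρ hg (M := M)
    (s := fun j : Fin d => treeEmb φ ρ g x W₁ W₂ k [j])
    (t := fun j : Fin d => treeEmb φ ρ g x W₁' W₂' k [j])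
    (fun j => Finset.le_sup' (fun j : Fin d =>
      ‖treeEmb φ ρ g x W₁ W₂ k [j] - treeEmb φ ρ g x W₁' W₂' k [j]‖) (Finset.mem_univ j))
  rw [Fintype.card_fin] at hR
  refine (norm_update_sub_le hCφ.le hφ W₁ W₂ W₁' W₂' (x []) _ _).trans ?_
  have h₁ := mul_le_mul_of_nonneg_left (hx []) (norm_nonneg (W₁ - W₁'))
  have h₂ := mul_le_mul hW₂' hR (norm_nonneg _) hB₂.le
  exact (mul_le_mul_of_nonneg_left (add_le_add_left (add_le_add h₁ h₂) _) hCφ.le).trans_eq (by ring)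
end

section
/- In the GNN computation-tree setting, the aggregation at the root satisfies ‖R(W₁,W₂,x_L)‖₂ ≤ C_ρ C_g d · min{ b√r , C_φ B₁ B_x · Σ_{ℓ=0}^{L−1} (C d)^ℓ }, where C = C_ρ C_g C_φ B₂ (so that Σ_{ℓ=0}^{L−1}(Cd)^ℓ = ((Cd)^L − 1)/(Cd − 1) when Cd ≠ 1). -/
open scoped BigOperators

theorem norm_apply_sum_le {E F G ι : Type*} [SeminormedAddCommGroup E] [SeminormedAddCommGroup F]
    [SeminormedAddCommGroup G] [Fintype ι] {ρ : F → G} {g : E → F} {Cρ Cg M : ℝ}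
    (hCρ : 0 ≤ Cρ) (hCg : 0 ≤ Cg) (hρ : ∀ u, ‖ρ u‖ ≤ Cρ * ‖u‖) (hg : ∀ u, ‖g u‖ ≤ Cg * ‖u‖)
    {v : ι → E} (hv : ∀ j, ‖v j‖ ≤ M) :
    ‖ρ (∑ j, g (v j))‖ ≤ Cρ * Cg * Fintype.card ι * M := by
  have hsum : ‖∑ j, g (v j)‖ ≤ ∑ _j : ι, Cg * M :=
    norm_sum_le_of_le _ fun j _ => (hg _).trans (by gcongr; exact hv j)
  calc ‖ρ (∑ j, g (v j))‖ ≤ Cρ * ∑ _j : ι, Cg * M := (hρ _).trans (by gcongr)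
    _ = Cρ * Cg * Fintype.card ι * M := by
      simp only [Finset.sum_const, Finset.card_univ, nsmul_eq_mul]
      ring

theorem EuclideanSpace.norm_le_mul_sqrt_card {ι : Type*} [Fintype ι] {b : ℝ} (hb : 0 ≤ b)
    (v : EuclideanSpace ℝ ι) (hv : ∀ i, |v i| ≤ b) : ‖v‖ ≤ b * √(Fintype.card ι) := by
  rw [EuclideanSpace.norm_eq]
  calc √(∑ i, ‖v i‖ ^ 2) ≤ √(∑ _i : ι, b ^ 2) := by
        gcongr with i
        exact hv i
    _ = b * √(Fintype.card ι) := by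
      rw [Finset.sum_const, Finset.card_univ, nsmul_eq_mul, mul_comm,
        Real.sqrt_mul (sq_nonneg b), Real.sqrt_sq hb]

theorem norm_treeEmb_le_geom_sum {r d : ℕ} {Bx B₁ B₂ Cφ Cρ Cg : ℝ}
    (hCφ : 0 ≤ Cφ) (hCρ : 0 ≤ Cρ) (hCg : 0 ≤ Cg)
    {φ ρ g : Er r → Er r} (hφ : ∀ u, ‖φ u‖ ≤ Cφ * ‖u‖) (hρ : ∀ u, ‖ρ u‖ ≤ Cρ * ‖u‖)
    (hg : ∀ u, ‖g u‖ ≤ Cg * ‖u‖) {x : List (Fin d) → Er r} (hx : ∀ u, ‖x u‖ ≤ Bx)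
    {W₁ W₂ : Er r →L[ℝ] Er r} (hW₁ : ‖W₁‖ ≤ B₁) (hW₂ : ‖W₂‖ ≤ B₂) (k : ℕ)
    (u : List (Fin d)) :
    ‖treeEmb φ ρ g x W₁ W₂ k u‖ ≤
      Cφ * B₁ * Bx * ∑ ℓ ∈ Finset.range (k + 1), ((Cρ * Cg * Cφ * B₂) * d) ^ ℓ := by
  have step : ∀ (u : List (Fin d)) (a : Er r) (A : ℝ), ‖a‖ ≤ A →
      ‖φ (W₁ (x u) + W₂ a)‖ ≤ Cφ * (B₁ * Bx + B₂ * A) := fun u a A ha =>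
    (hφ _).trans <| mul_le_mul_of_nonneg_left
      (norm_add_le_of_le (W₁.le_of_opNorm_le_of_le hW₁ (hx u))
        (W₂.le_of_opNorm_le_of_le hW₂ ha)) hCφ
  induction k generalizing u with
  | zero =>
    have hρ0 : ‖ρ 0‖ ≤ 0 := by simpa using hρ 0
    calc ‖treeEmb φ ρ g x W₁ W₂ 0 u‖ ≤ Cφ * (B₁ * Bx + B₂ * 0) := step u _ _ hρ0
      _ = _ := by simp [mul_assoc]
  | succ k ih =>
    refine (step u _ _ (norm_apply_sum_le hCρ hCg hρ hg fun j => ih (u ++ [j]))).trans_eq ?_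
    rw [Fintype.card_fin, geom_sum_succ (n := k + 1)]
    ring

/-- **Lemma 2 of the paper.** Bound on the permutation-invariant
aggregation at the root:
`‖R(W₁,W₂,x_L)‖₂ ≤ C_ρ C_g d · min{ b√r , C_φ B₁ B_x Σ_{ℓ=0}^{L−1} (Cd)^ℓ }`
where `C = C_ρ C_g C_φ B₂`. -/
theorem treeEmb_aggregation_bound
    (r d L : ℕ) (hr : 1 ≤ r) (hd : 1 ≤ d) (hL : 1 ≤ L)
    (Bx B₁ B₂ b Cφ Cρ Cg : ℝ)
    (hBx : 0 < Bx) (hB₁ : 0 < B₁) (hB₂ : 0 < B₂) (hb : 0 < b)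
    (hCφ : 0 < Cφ) (hCρ : 0 < Cρ) (hCg : 0 < Cg)
    (φ ρ g : Er r → Er r)
    (hφ : ∀ u v, ‖φ u - φ v‖ ≤ Cφ * ‖u - v‖)
    (hρ : ∀ u v, ‖ρ u - ρ v‖ ≤ Cρ * ‖u - v‖)
    (hg : ∀ u v, ‖g u - g v‖ ≤ Cg * ‖u - v‖)
    (hφ0 : φ 0 = 0) (hρ0 : ρ 0 = 0) (hg0 : g 0 = 0)
    (hφb : ∀ u (i : Fin r), |φ u i| ≤ b)
    (x : List (Fin d) → Er r) (hx : ∀ u, ‖x u‖ ≤ Bx)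
    (W₁ W₂ : Er r →L[ℝ] Er r) (hW₁ : ‖W₁‖ ≤ B₁) (hW₂ : ‖W₂‖ ≤ B₂) :
    ‖ρ (∑ j : Fin d, g (treeEmb φ ρ g x W₁ W₂ (L - 1) [j]))‖ ≤
      Cρ * Cg * d *
        min (b * Real.sqrt r)
          (Cφ * B₁ * Bx *
            ∑ ℓ ∈ Finset.range L, ((Cρ * Cg * Cφ * B₂) * d) ^ ℓ) := by
  have hφ' : ∀ u, ‖φ u‖ ≤ Cφ * ‖u‖ := fun u => by simpa [hφ0] using hφ u 0
  have hρ' : ∀ u, ‖ρ u‖ ≤ Cρ * ‖u‖ := fun u => by simpa [hρ0] using hρ u 0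
  have hg' : ∀ u, ‖g u‖ ≤ Cg * ‖u‖ := fun u => by simpa [hg0] using hg u 0
  have hv : ∀ j : Fin d, ‖treeEmb φ ρ g x W₁ W₂ (L - 1) [j]‖ ≤ min (b * Real.sqrt r)
      (Cφ * B₁ * Bx * ∑ ℓ ∈ Finset.range L, ((Cρ * Cg * Cφ * B₂) * d) ^ ℓ) := by
    refine fun j => le_min ?_ ?_
    · have hb' : ∀ v, ‖φ v‖ ≤ b * √r := fun v => by
        simpa using EuclideanSpace.norm_le_mul_sqrt_card hb.le (φ v) (hφb v)
      cases L - 1 <;> exact hb' _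
    · simpa only [Nat.sub_add_cancel hL] using
        norm_treeEmb_le_geom_sum hCφ.le hCρ.le hCg.le hφ' hρ' hg' hx
          hW₁ hW₂ (L - 1) [j]
  simpa only [Fintype.card_fin] using norm_apply_sum_le hCρ.le hCg.le hρ' hg' hv
end

section
/- In the GNN computation-tree setting, set R̄ = C_ρ C_g d · min{ b√r , C_φ B₁ B_x Σ_{ℓ=0}^{L−1}(Cd)^ℓ }, Z = C_φ B₁ B_x + C_φ B₂ R̄, M = C_φ Σ_{ℓ=0}^{L−1}(Cd)^ℓ, and C = C_ρ C_g C_φ B₂. Then for every ε > 0 there exists a finite set S of parameter triples (W₁′, W₂′, β′) with ‖W₁′‖₂ ≤ B₁, ‖W₂′‖₂ ≤ B₂, ‖β′‖₂ ≤ B_β, of cardinality |S| ≤ (1 + 6 B_β max{ Z, M √r · max{B_x B₁, R̄ B₂} } / ε)^{3r²}, such that for every triple (W₁, W₂, β) with ‖W₁‖₂ ≤ B₁, ‖W₂‖₂ ≤ B₂, ‖β‖₂ ≤ B_β there is (W₁′,W₂′,β′) ∈ S with |ψ(βᵀ T_L(W₁,W₂)) − ψ(β′ᵀ T_L(W₁′,W₂′))|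 ≤ ε for every admissible assignment of tree features (every choice of x_u with ‖x_u‖₂ ≤ B_x), where ψ is the sigmoid function. -/
open scoped BigOperators

open MeasureTheory Module

section Covering

variable {E : Type*} [NormedAddCommGroup E] [NormedSpace ℝ E] [FiniteDimensional ℝ E]

/-- Volumetric bound on the cardinality of an `η R`-separated subset of the ball of radius `R`. -/
theorem card_le_of_separated_of_norm_le {R η : ℝ} (hR : 0 < R) (hη : 0 < η) (s : Finset E)
    (hs : ∀ c ∈ s, ‖c‖ ≤ R) (h : ∀ c ∈ s, ∀ c' ∈ s, c ≠ c' → η * R ≤ ‖c - c'‖) :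
    (s.card : ℝ) ≤ (1 + 2 / η) ^ finrank ℝ E := by
  borelize E
  let μ : Measure E := Measure.addHaar
  set δ : ℝ := η * R / 2 with hδ
  have hδ0 : 0 < δ := by positivity
  have hρ0 : 0 < R + δ := by positivity
  have hdisj : Set.Pairwise (s : Set E) (Function.onFun Disjoint fun c => Metric.ball c δ) := by
    intro c hc c' hc' hne
    apply Metric.ball_disjoint_ball
    rw [dist_eq_norm]
    linarith [h c hc c' hc' hne]
  have hsub : (⋃ c ∈ s, Metric.ball c δ) ⊆ Metric.ball (0 : E) (R + δ) := by
    refine Set.iUnion₂_subset fun c hc => Metric.ball_subset_ball' ?_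
    rw [dist_zero_right]
    linarith [hs c hc]
  have hvol : (s.card : ENNReal) * ENNReal.ofReal (δ ^ finrank ℝ E) * μ (Metric.ball 0 1) ≤
      ENNReal.ofReal ((R + δ) ^ finrank ℝ E) * μ (Metric.ball 0 1) :=
    calc
      _ = μ (⋃ c ∈ s, Metric.ball c δ) := by
        rw [measure_biUnion_finset hdisj fun c _ => Metric.isOpen_ball.measurableSet]
        simp only [μ.addHaar_ball_of_pos _ hδ0, Finset.sum_const, nsmul_eq_mul, mul_assoc]
      _ ≤ μ (Metric.ball (0 : E) (R + δ)) := measure_mono hsub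
      _ = _ := μ.addHaar_ball_of_pos _ hρ0
  have hcard : (s.card : ENNReal) * ENNReal.ofReal (δ ^ finrank ℝ E) ≤
      ENNReal.ofReal ((R + δ) ^ finrank ℝ E) :=
    (ENNReal.mul_le_mul_iff_left (Metric.measure_ball_pos _ _ zero_lt_one).ne'
      measure_ball_lt_top.ne).1 hvol
  have hreal : (s.card : ℝ) * δ ^ finrank ℝ E ≤ (R + δ) ^ finrank ℝ E := by
    have := ENNReal.toReal_le_of_le_ofReal (by positivity) hcard
    rwa [ENNReal.toReal_mul, ENNReal.toReal_natCast, ENNReal.toReal_ofReal (by positivity)] at this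
  have hbase : 1 + 2 / η = (R + δ) / δ := by
    rw [hδ]
    field_simp
    ring
  rw [hbase, div_pow]
  exact (le_div_iff₀ (by positivity)).2 hreal

/-- The ball of radius `R` has an internal `η R`-cover of cardinality at most
`(1 + 2 / η) ^ dim`. -/
theorem exists_finset_cover_ball (E : Type*) [NormedAddCommGroup E] [NormedSpace ℝ E]
    [FiniteDimensional ℝ E] {R η : ℝ} (hR : 0 < R) (hη : 0 < η) :
    ∃ s : Finset E, (∀ c ∈ s, ‖c‖ ≤ R) ∧ (s.card : ℝ) ≤ (1 + 2 / η) ^ finrank ℝ E ∧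
      ∀ v : E, ‖v‖ ≤ R → ∃ c ∈ s, ‖v - c‖ ≤ η * R := by
  classical
  by_contra! hcon
  have hsep : ∀ n : ℕ, ∃ s : Finset E, s.card = n ∧ (∀ c ∈ s, ‖c‖ ≤ R) ∧
      ∀ c ∈ s, ∀ c' ∈ s, c ≠ c' → η * R ≤ ‖c - c'‖ := by
    intro n
    induction n with
    | zero => exact ⟨∅, by simp⟩
    | succ n ih =>
      obtain ⟨s, hn, hs, h⟩ := ih
      obtain ⟨v, hv, hfar⟩ := hcon s hs (card_le_of_separated_of_norm_le hR hη s hs h)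
      have hvs : v ∉ s := fun hmem => by
        have := hfar v hmem
        rw [sub_self, norm_zero] at this
        exact this.not_gt (by positivity)
      refine ⟨insert v s, by rw [Finset.card_insert_of_notMem hvs, hn], ?_, ?_⟩
      · intro c hc
        rcases Finset.mem_insert.1 hc with rfl | hc
        exacts [hv, hs c hc]
      · intro c hc c' hc' hne
        rcases Finset.mem_insert.1 hc with rfl | hcs <;>
          rcases Finset.mem_insert.1 hc' with rfl | hcs'
        · exact absurd rfl hne
        · exact (hfar c' hcs').le
        · rw [norm_sub_rev]
          exact (hfar c hcs).le
        · exact h c hcs c' hcs' hne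
  obtain ⟨n, hn⟩ := exists_nat_gt ((1 + 2 / η) ^ finrank ℝ E)
  obtain ⟨s, rfl, hs, h⟩ := hsep n
  exact hn.not_ge (card_le_of_separated_of_norm_le hR hη s hs h)

end Covering

theorem finrank_continuousLinearMap_Er (r : ℕ) : finrank ℝ (Er r →L[ℝ] Er r) = r ^ 2 := by
  rw [← (LinearMap.toContinuousLinearMap (𝕜 := ℝ) (E := Er r) (F' := Er r)).finrank_eq,
    finrank_linearMap, finrank_euclideanSpace_fin, sq]

theorem finiteDimensional_continuousLinearMap_Er (r : ℕ) :
    FiniteDimensional ℝ (Er r →L[ℝ] Er r) :=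
  LinearEquiv.finiteDimensional (LinearMap.toContinuousLinearMap (𝕜 := ℝ) (E := Er r) (F' := Er r))

theorem norm_le_mul_sqrt_of_abs_le {r : ℕ} {b : ℝ} (hb : 0 ≤ b) (v : Er r)
    (hv : ∀ i, |v i| ≤ b) : ‖v‖ ≤ b * √r := by
  rw [EuclideanSpace.norm_eq]
  refine Real.sqrt_le_iff.2 ⟨by positivity, ?_⟩
  rw [mul_pow, Real.sq_sqrt (Nat.cast_nonneg r), mul_comm]
  calc ∑ i, ‖v i‖ ^ 2 ≤ ∑ _i : Fin r, b ^ 2 :=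
        Finset.sum_le_sum fun i _ => pow_le_pow_left₀ (norm_nonneg _) (hv i) 2
    _ = r * b ^ 2 := by simp

theorem abs_sigmoid_sub_le (x y : ℝ) :
    |1 / (1 + Real.exp (-x)) - 1 / (1 + Real.exp (-y))| ≤ 1 / 4 * |x - y| := by
  have h := Convex.norm_image_sub_le_of_norm_deriv_le (f := Real.sigmoid) (C := 1 / 4)
    (s := Set.univ) (x := y) (y := x) (fun z _ => (differentiable_sigmoid z)) (fun z _ => by
      rw [Real.deriv_sigmoid, Real.norm_eq_abs, abs_le]
      constructor <;>
        nlinarith [Real.sigmoid_pos z, Real.sigmoid_lt_one z, sq_nonneg (Real.sigmoid z - 1 / 2)])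
    convex_univ (Set.mem_univ _) (Set.mem_univ _)
  simpa [Real.sigmoid_def, Real.norm_eq_abs] using h

theorem abs_sum_mul_sub_sum_mul_le {r : ℕ} (β β' v v' : Er r) :
    |∑ i, β i * v i - ∑ i, β' i * v' i| ≤ ‖β - β'‖ * ‖v‖ + ‖β'‖ * ‖v - v'‖ := by
  have hinner : ∀ a c : Er r, ∑ i, a i * c i = inner ℝ a c := fun a c => by
    simp [PiLp.inner_apply, mul_comm]
  rw [hinner, hinner, show inner ℝ β v - inner ℝ β' v' = inner ℝ (β - β') v + inner ℝ β' (v - v') by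
    rw [inner_sub_left, inner_sub_right]; ring]
  exact (abs_add_le _ _).trans (add_le_add (abs_real_inner_le_norm _ _)
    (abs_real_inner_le_norm _ _))

section Tree

variable {r d : ℕ} {φ ρ g : Er r → Er r} {Bx B₁ B₂ Cφ Cρ Cg : ℝ}

theorem norm_aggregate_sub_le_s13 (hCρ : 0 ≤ Cρ) (hCg : 0 ≤ Cg)
    (hρ : ∀ u v, ‖ρ u - ρ v‖ ≤ Cρ * ‖u - v‖) (hg : ∀ u v, ‖g u - g v‖ ≤ Cg * ‖u - v‖)
    {t : ℝ} (v w : Fin d → Er r) (h : ∀ j, ‖v j - w j‖ ≤ t) :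
    ‖ρ (∑ j, g (v j)) - ρ (∑ j, g (w j))‖ ≤ Cρ * Cg * d * t := by
  refine (hρ _ _).trans ?_
  rw [mul_assoc, mul_assoc, ← Finset.sum_sub_distrib]
  refine mul_le_mul_of_nonneg_left ?_ hCρ
  calc ‖∑ j, (g (v j) - g (w j))‖ ≤ ∑ _j : Fin d, Cg * t :=
        norm_sum_le_of_le _ fun j _ => (hg _ _).trans (mul_le_mul_of_nonneg_left (h j) hCg)
    _ = Cg * (d * t) := by simp; ring

theorem norm_aggregate_le (hCρ : 0 ≤ Cρ) (hCg : 0 ≤ Cg)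
    (hρ : ∀ u v, ‖ρ u - ρ v‖ ≤ Cρ * ‖u - v‖) (hg : ∀ u v, ‖g u - g v‖ ≤ Cg * ‖u - v‖)
    (hρ0 : ρ 0 = 0) (hg0 : g 0 = 0) {t : ℝ} (v : Fin d → Er r) (h : ∀ j, ‖v j‖ ≤ t) :
    ‖ρ (∑ j, g (v j))‖ ≤ Cρ * Cg * d * t := by
  simpa [hg0, hρ0] using
    norm_aggregate_sub_le_s13 hCρ hCg hρ hg v (fun _ => 0) (fun j => by simpa using h j)

theorem norm_update_le (hCφ : 0 ≤ Cφ) (hφ : ∀ u v, ‖φ u - φ v‖ ≤ Cφ * ‖u - v‖) (hφ0 : φ 0 = 0)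
    (hB₁ : 0 ≤ B₁) (hB₂ : 0 ≤ B₂) {W₁ W₂ : Er r →L[ℝ] Er r} (hW₁ : ‖W₁‖ ≤ B₁) (hW₂ : ‖W₂‖ ≤ B₂)
    {x y : Er r} {R : ℝ} (hx : ‖x‖ ≤ Bx) (hy : ‖y‖ ≤ R) :
    ‖φ (W₁ x + W₂ y)‖ ≤ Cφ * B₁ * Bx + Cφ * B₂ * R := by
  have h := hφ (W₁ x + W₂ y) 0
  rw [hφ0, sub_zero, sub_zero] at h
  refine h.trans ?_
  rw [mul_assoc, mul_assoc, ← mul_add]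
  refine mul_le_mul_of_nonneg_left ((norm_add_le _ _).trans (add_le_add ?_ ?_)) hCφ
  · exact (W₁.le_opNorm x).trans (mul_le_mul hW₁ hx (norm_nonneg _) hB₁)
  · exact (W₂.le_opNorm y).trans (mul_le_mul hW₂ hy (norm_nonneg _) hB₂)

theorem norm_update_sub_le_s13 (hCφ : 0 ≤ Cφ) (hφ : ∀ u v, ‖φ u - φ v‖ ≤ Cφ * ‖u - v‖)
    (hB₂ : 0 ≤ B₂) {W₁ W₂ W₁' W₂' : Er r →L[ℝ] Er r} (hW₂' : ‖W₂'‖ ≤ B₂) {D₁ D₂ : ℝ}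
    (hD₁ : ‖W₁ - W₁'‖ ≤ D₁) (hD₂ : ‖W₂ - W₂'‖ ≤ D₂)
    {x y y' : Er r} {R t : ℝ} (hx : ‖x‖ ≤ Bx) (hy : ‖y‖ ≤ R) (hyy' : ‖y - y'‖ ≤ t) :
    ‖φ (W₁ x + W₂ y) - φ (W₁' x + W₂' y')‖ ≤ Cφ * (D₁ * Bx + D₂ * R + B₂ * t) := by
  refine (hφ _ _).trans (mul_le_mul_of_nonneg_left ?_ hCφ)
  have hsplit : W₁ x + W₂ y - (W₁' x + W₂' y') =
      (W₁ - W₁') x + (W₂ - W₂') y + W₂' (y - y') := by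
    simp only [sub_apply, map_sub]
    abel
  rw [hsplit]
  refine (norm_add₃_le).trans (add_le_add (add_le_add ?_ ?_) ?_)
  · exact ((W₁ - W₁').le_opNorm x).trans
      (mul_le_mul hD₁ hx (norm_nonneg _) ((norm_nonneg _).trans hD₁))
  · exact ((W₂ - W₂').le_opNorm y).trans
      (mul_le_mul hD₂ hy (norm_nonneg _) ((norm_nonneg _).trans hD₂))
  · exact (W₂'.le_opNorm _).trans (mul_le_mul hW₂' hyy' (norm_nonneg _) hB₂)

variable {x : List (Fin d) → Er r}

theorem norm_treeEmb_le_geom (hCφ : 0 ≤ Cφ) (hCρ : 0 ≤ Cρ) (hCg : 0 ≤ Cg)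
    (hφ : ∀ u v, ‖φ u - φ v‖ ≤ Cφ * ‖u - v‖)
    (hρ : ∀ u v, ‖ρ u - ρ v‖ ≤ Cρ * ‖u - v‖) (hg : ∀ u v, ‖g u - g v‖ ≤ Cg * ‖u - v‖)
    (hφ0 : φ 0 = 0) (hρ0 : ρ 0 = 0) (hg0 : g 0 = 0) (hB₁ : 0 ≤ B₁) (hB₂ : 0 ≤ B₂)
    {W₁ W₂ : Er r →L[ℝ] Er r} (hW₁ : ‖W₁‖ ≤ B₁) (hW₂ : ‖W₂‖ ≤ B₂) (hx : ∀ u, ‖x u‖ ≤ Bx)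
    (k : ℕ) (u : List (Fin d)) :
    ‖treeEmb φ ρ g x W₁ W₂ k u‖ ≤
      Cφ * B₁ * Bx * ∑ ℓ ∈ Finset.range (k + 1), (Cρ * Cg * Cφ * B₂ * d) ^ ℓ := by
  induction k generalizing u with
  | zero =>
    simpa [treeEmb] using norm_update_le hCφ hφ hφ0 hB₁ hB₂ hW₁ hW₂ (hx u)
      (show ‖ρ 0‖ ≤ 0 by simp [hρ0])
  | succ k ih =>
    refine (norm_update_le hCφ hφ hφ0 hB₁ hB₂ hW₁ hW₂ (hx u) (norm_aggregate_le hCρ hCg hρ hg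
      hρ0 hg0 (fun j => treeEmb φ ρ g x W₁ W₂ k (u ++ [j])) fun j => ih _)).trans_eq ?_
    rw [geom_sum_succ (n := k + 1)]
    ring

/-- Perturbation bound for the embeddings up to depth `L`, when the aggregated messages entering
the update are bounded by `R`. -/
theorem norm_treeEmb_sub_le (hCφ : 0 ≤ Cφ) (hCρ : 0 ≤ Cρ) (hCg : 0 ≤ Cg)
    (hφ : ∀ u v, ‖φ u - φ v‖ ≤ Cφ * ‖u - v‖)
    (hρ : ∀ u v, ‖ρ u - ρ v‖ ≤ Cρ * ‖u - v‖) (hg : ∀ u v, ‖g u - g v‖ ≤ Cg * ‖u - v‖)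
    (hρ0 : ρ 0 = 0) (hB₂ : 0 ≤ B₂)
    {W₁ W₂ W₁' W₂' : Er r →L[ℝ] Er r} (hW₂' : ‖W₂'‖ ≤ B₂) {D₁ D₂ R : ℝ}
    (hD₁ : ‖W₁ - W₁'‖ ≤ D₁) (hD₂ : ‖W₂ - W₂'‖ ≤ D₂) (hx : ∀ u, ‖x u‖ ≤ Bx) {L : ℕ}
    (hR : ∀ k < L, ∀ u, ‖ρ (∑ j : Fin d, g (treeEmb φ ρ g x W₁ W₂ k (u ++ [j])))‖ ≤ R)
    (k : ℕ) (hk : k ≤ L) (u : List (Fin d)) :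
    ‖treeEmb φ ρ g x W₁ W₂ k u - treeEmb φ ρ g x W₁' W₂' k u‖ ≤
      Cφ * D₁ * Bx * ∑ ℓ ∈ Finset.range (k + 1), (Cρ * Cg * Cφ * B₂ * d) ^ ℓ +
        Cφ * D₂ * R * ∑ ℓ ∈ Finset.range k, (Cρ * Cg * Cφ * B₂ * d) ^ ℓ := by
  induction k generalizing u with
  | zero =>
    refine (norm_update_sub_le_s13 hCφ hφ hB₂ hW₂' hD₁ hD₂ (hx u) (show ‖ρ 0‖ ≤ 0 by simp [hρ0])
      (show ‖ρ 0 - ρ 0‖ ≤ 0 by simp)).trans_eq ?_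
    simp [mul_assoc]
  | succ k ih =>
    refine (norm_update_sub_le_s13 hCφ hφ hB₂ hW₂' hD₁ hD₂ (hx u) (hR k hk u)
      (norm_aggregate_sub_le_s13 hCρ hCg hρ hg (fun j => treeEmb φ ρ g x W₁ W₂ k (u ++ [j]))
        (fun j => treeEmb φ ρ g x W₁' W₂' k (u ++ [j]))
        fun j => ih (Nat.le_of_succ_le hk) _)).trans_eq ?_
    rw [geom_sum_succ (n := k + 1), geom_sum_succ (n := k)]
    ring

end Tree

/-- Trading accuracy in the readout vector against accuracy in the feature weights costs no more
than the balanced choice, provided the output range `t` exceeds `2 e`. -/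
theorem unbalanced_cover_le {e t A K : ℝ} (he : 0 < e) (hA : 0 < A) (het : 2 * e < t)
    (htK : t ≤ K) (htA : t * A ≤ 2 * K ^ 2) :
    (1 + 2 / (2 * e / A)) * (1 + 2 / (4 * e / (3 * t))) ≤ (1 + 6 * K / e) ^ 2 := by
  have ht : 0 < t := by linarith
  have hleft : (1 + 2 / (2 * e / A)) * (1 + 2 / (4 * e / (3 * t))) =
      (e + A) * (e + 3 * t / 2) / e ^ 2 := by
    field_simp
    ring
  have hright : (1 + 6 * K / e) ^ 2 = (e + 6 * K) ^ 2 / e ^ 2 := by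
    field_simp
  rw [hleft, hright]
  gcongr
  nlinarith [mul_pos he hA, mul_pos he ht, mul_le_mul_of_nonneg_left htK he.le,
    mul_le_mul_of_nonneg_right het.le hA.le]

/-- Cardinality of the product of the three parameter covers. -/
theorem card_product_le {e t A K : ℝ} (he : 0 < e) (hA : 0 < A) (het : 2 * e < t)
    (htK : t ≤ K) (htA : t * A ≤ 2 * K ^ 2) {r : ℕ} {c₁ c₂ c₃ : ℝ} (h₂ : 0 ≤ c₂) (h₃ : 0 ≤ c₃)
    (hc₁ : c₁ ≤ (1 + 2 / (2 * e / A)) ^ r ^ 2)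
    (hc₂ : c₂ ≤ (1 + 2 / (e / (3 * K))) ^ r ^ 2)
    (hc₃ : c₃ ≤ (1 + 2 / (4 * e / (3 * t))) ^ r) :
    c₁ * (c₂ * c₃) ≤ (1 + 6 * K / e) ^ (3 * r ^ 2) := by
  have ht : 0 < t := by linarith
  have hK : 0 < K := by linarith
  have hc₃' : c₃ ≤ (1 + 2 / (4 * e / (3 * t))) ^ r ^ 2 :=
    hc₃.trans (pow_le_pow_right₀ (le_add_of_nonneg_right (by positivity))
      (Nat.le_self_pow two_ne_zero r))
  have hbase : 1 + 2 / (e / (3 * K)) = 1 + 6 * K / e := by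
    field_simp
    ring
  rw [hbase] at hc₂
  calc c₁ * (c₂ * c₃)
      ≤ (1 + 2 / (2 * e / A)) ^ r ^ 2 *
          ((1 + 6 * K / e) ^ r ^ 2 * (1 + 2 / (4 * e / (3 * t))) ^ r ^ 2) := by gcongr
    _ = ((1 + 2 / (2 * e / A)) * (1 + 2 / (4 * e / (3 * t))) * (1 + 6 * K / e)) ^ r ^ 2 := by
        rw [mul_pow, mul_pow]
        ring
    _ ≤ ((1 + 6 * K / e) ^ 2 * (1 + 6 * K / e)) ^ r ^ 2 := by
        gcongr
        exact unbalanced_cover_le he hA het htK htA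
    _ = (1 + 6 * K / e) ^ (3 * r ^ 2) := by rw [← pow_succ, ← pow_mul]

/-- **Lemma 4 of the paper.** Covering-number bound: for every
`ε > 0` there is a set of parameter triples of cardinality at most
`(1 + 6 B_β max{Z, M √r max{B_x B₁, Rb B₂}}/ε)^{3r²}` approximating every
admissible parameter triple to within `ε` in prediction probability, uniformly
over admissible tree features. -/
theorem treeEmb_covering_bound
    (r d L : ℕ) (hr : 1 ≤ r) (hd : 1 ≤ d) (hL : 1 ≤ L)
    (Bx B₁ B₂ Bβ b Cφ Cρ Cg : ℝ)
    (hBx : 0 < Bx) (hB₁ : 0 < B₁) (hB₂ : 0 < B₂) (hBβ : 0 < Bβ) (hb : 0 < b)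
    (hCφ : 0 < Cφ) (hCρ : 0 < Cρ) (hCg : 0 < Cg)
    (φ ρ g : Er r → Er r)
    (hφ : ∀ u v, ‖φ u - φ v‖ ≤ Cφ * ‖u - v‖)
    (hρ : ∀ u v, ‖ρ u - ρ v‖ ≤ Cρ * ‖u - v‖)
    (hg : ∀ u v, ‖g u - g v‖ ≤ Cg * ‖u - v‖)
    (hφ0 : φ 0 = 0) (hρ0 : ρ 0 = 0) (hg0 : g 0 = 0)
    (hφb : ∀ u (i : Fin r), |φ u i| ≤ b)
    (ε : ℝ) (hε : 0 < ε) :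
    -- abbreviations
    let C : ℝ := Cρ * Cg * Cφ * B₂
    let Rb : ℝ := Cρ * Cg * d * min (b * Real.sqrt r)
        (Cφ * B₁ * Bx * ∑ ℓ ∈ Finset.range L, (C * d) ^ ℓ)
    let Z : ℝ := Cφ * B₁ * Bx + Cφ * B₂ * Rb
    let M : ℝ := Cφ * ∑ ℓ ∈ Finset.range L, (C * d) ^ ℓ
    let ψ : ℝ → ℝ := fun z => 1 / (1 + Real.exp (-z))
    ∃ S : Finset ((Er r →L[ℝ] Er r) × (Er r →L[ℝ] Er r) × Er r),
      (∀ W₁' W₂' β', (W₁', W₂', β') ∈ S →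
          ‖W₁'‖ ≤ B₁ ∧ ‖W₂'‖ ≤ B₂ ∧ ‖β'‖ ≤ Bβ) ∧
      (S.card : ℝ) ≤
        (1 + 6 * Bβ * max Z (M * Real.sqrt r * max (Bx * B₁) (Rb * B₂)) / ε)
          ^ (3 * r ^ 2) ∧
      (∀ (W₁ W₂ : Er r →L[ℝ] Er r) (β : Er r),
        ‖W₁‖ ≤ B₁ → ‖W₂‖ ≤ B₂ → ‖β‖ ≤ Bβ →
        ∃ W₁' W₂' β', (W₁', W₂', β') ∈ S ∧
          ∀ x : List (Fin d) → Er r, (∀ u, ‖x u‖ ≤ Bx) →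
            |ψ (∑ i : Fin r, β i * treeEmb φ ρ g x W₁ W₂ L [] i) -
              ψ (∑ i : Fin r, β' i * treeEmb φ ρ g x W₁' W₂' L [] i)| ≤ ε) := by
  intro C Rb Z M ψ
  set Q : ℝ := ∑ ℓ ∈ Finset.range L, (C * d) ^ ℓ with hQ
  set K : ℝ := max Z (M * √r * max (Bx * B₁) (Rb * B₂))
  set s : ℝ := b * √r
  set t : ℝ := min s Z
  set A : ℝ := Cφ * B₁ * Bx * ∑ ℓ ∈ Finset.range (L + 1), (C * d) ^ ℓ with hA
  have hr1 : 1 ≤ √(r : ℝ) := Real.one_le_sqrt.2 (by exact_mod_cast hr)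
  have hd0 : (0 : ℝ) < d := by exact_mod_cast hd
  have hC0 : 0 < C := by positivity
  have hQ0 : 0 < Q := Finset.sum_pos (fun _ _ => by positivity) ⟨0, Finset.mem_range.2 hL⟩
  have hs0 : 0 < s := by positivity
  have ha0 : 0 < Cφ * B₁ * Bx := by positivity
  have hm0 : 0 < min s (Cφ * B₁ * Bx * Q) := lt_min hs0 (by positivity)
  have hRb0 : 0 < Rb := by positivity
  have hZ0 : 0 < Z := by positivity
  have hA0 : 0 < A :=
    mul_pos ha0 (Finset.sum_pos (fun _ _ => by positivity) ⟨0, by simp⟩)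
  have hM0 : 0 < M := by positivity
  have hZK : Z ≤ K := le_max_left _ _
  have hK0 : 0 < K := hZ0.trans_le hZK
  have haZ : Cφ * B₁ * Bx ≤ Z := le_add_of_nonneg_right (by positivity)
  have hMK : M * (Rb * B₂) ≤ K := by
    refine le_trans ?_ (le_max_right _ _)
    gcongr
    · exact le_mul_of_one_le_right hM0.le hr1
    · exact le_max_right _ _
  have htK : t ≤ K := (min_le_right _ _).trans hZK
  have ht0 : 0 < t := lt_min hs0 hZ0
  have hA_eq : A = Cφ * B₁ * Bx + C * d * (Cφ * B₁ * Bx * Q) := by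
    rw [hA, hQ, geom_sum_succ]
    ring
  have htA : t * A ≤ 2 * K ^ 2 := by
    rcases le_total s (Cφ * B₁ * Bx * Q) with h | h
    · have hMR : M * (Rb * B₂) = Q * (C * d) * s := by
        simp only [M, Rb, C]
        rw [min_eq_left h]
        ring
      have h₁ : t * (Cφ * B₁ * Bx) ≤ K * K := mul_le_mul htK (haZ.trans hZK) ha0.le hK0.le
      have h₂ : t * (C * d * (Cφ * B₁ * Bx * Q)) ≤ K * K := by
        calc t * (C * d * (Cφ * B₁ * Bx * Q)) ≤ s * (C * d * (Cφ * B₁ * Bx * Q)) :=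
              mul_le_mul_of_nonneg_right (min_le_left _ _) (by positivity)
          _ = (M * (Rb * B₂)) * (Cφ * B₁ * Bx) := by rw [hMR]; ring
          _ ≤ K * K := mul_le_mul hMK (haZ.trans hZK) ha0.le hK0.le
      rw [hA_eq]
      linarith
    · have hAZ : A = Z := by
        rw [hA_eq]
        simp only [Z, Rb, C]
        rw [min_eq_right h]
        ring
      have := mul_le_mul htK (hAZ.trans_le hZK) hA0.le hK0.le
      nlinarith [sq_nonneg K]
  have hbound : ∀ (W₁ W₂ : Er r →L[ℝ] Er r), ‖W₁‖ ≤ B₁ → ‖W₂‖ ≤ B₂ →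
      ∀ x : List (Fin d) → Er r, (∀ u, ‖x u‖ ≤ Bx) → ∀ k < L, ∀ u,
        ‖ρ (∑ j : Fin d, g (treeEmb φ ρ g x W₁ W₂ k (u ++ [j])))‖ ≤ Rb := by
    intro W₁ W₂ hW₁ hW₂ x hx k hk u
    refine norm_aggregate_le hCρ.le hCg.le hρ hg hρ0 hg0 _ fun j => le_min ?_ ?_
    · cases k <;> exact norm_le_mul_sqrt_of_abs_le hb.le _ fun i => hφb _ i
    · refine (norm_treeEmb_le_geom hCφ.le hCρ.le hCg.le hφ hρ hg hφ0 hρ0 hg0 hB₁.le hB₂.le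
        hW₁ hW₂ hx k _).trans (mul_le_mul_of_nonneg_left ?_ ha0.le)
      exact Finset.sum_le_sum_of_subset_of_nonneg (Finset.range_mono hk)
        fun _ _ _ => by positivity
  have hroot : ∀ (W₁ W₂ : Er r →L[ℝ] Er r), ‖W₁‖ ≤ B₁ → ‖W₂‖ ≤ B₂ →
      ∀ x : List (Fin d) → Er r, (∀ u, ‖x u‖ ≤ Bx) → ‖treeEmb φ ρ g x W₁ W₂ L []‖ ≤ t := by
    intro W₁ W₂ hW₁ hW₂ x hx
    obtain ⟨k, rfl⟩ := Nat.exists_eq_add_of_le' hL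
    exact le_min (norm_le_mul_sqrt_of_abs_le hb.le _ fun i => hφb _ i)
      (norm_update_le hCφ.le hφ hφ0 hB₁.le hB₂.le hW₁ hW₂ (hx _)
        (hbound W₁ W₂ hW₁ hW₂ x hx k k.lt_succ_self []))
  clear_value A t K s
  obtain ⟨e, rfl⟩ : ∃ e, ε = Bβ * e := ⟨ε / Bβ, by field_simp⟩
  have he0 : 0 < e := (mul_pos_iff_of_pos_left hBβ).1 hε
  have hP : 6 * Bβ * K / (Bβ * e) = 6 * K / e := by field_simp
  rw [hP]
  rcases le_or_gt t (2 * e) with hte | hte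
  · refine ⟨{(0, 0, 0)}, ?_, ?_, ?_⟩
    · intro W₁' W₂' β' h
      simp only [Finset.mem_singleton, Prod.mk.injEq] at h
      obtain ⟨rfl, rfl, rfl⟩ := h
      simp [hB₁.le, hB₂.le, hBβ.le]
    · rw [Finset.card_singleton, Nat.cast_one]
      exact one_le_pow₀ (le_add_of_nonneg_right (by positivity))
    · intro W₁ W₂ β hW₁ hW₂ hβ
      refine ⟨0, 0, 0, Finset.mem_singleton_self _, fun x hx => ?_⟩
      refine (abs_sigmoid_sub_le _ _).trans ?_
      have h₁ := abs_sum_mul_sub_sum_mul_le β 0 (treeEmb φ ρ g x W₁ W₂ L [])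
        (treeEmb φ ρ g x 0 0 L [])
      rw [sub_zero, norm_zero, zero_mul, add_zero] at h₁
      have h₂ := mul_le_mul hβ (hroot W₁ W₂ hW₁ hW₂ x hx) (norm_nonneg _) hBβ.le
      have h₃ := mul_le_mul_of_nonneg_left hte hBβ.le
      linarith
  · have := finiteDimensional_continuousLinearMap_Er r
    obtain ⟨S₁, hS₁, hcard₁, hcov₁⟩ := exists_finset_cover_ball (Er r →L[ℝ] Er r) hB₁
      (show 0 < 2 * e / A by positivity)
    obtain ⟨S₂, hS₂, hcard₂, hcov₂⟩ := exists_finset_cover_ball (Er r →L[ℝ] Er r) hB₂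
      (show 0 < e / (3 * K) by positivity)
    obtain ⟨S₃, hS₃, hcard₃, hcov₃⟩ := exists_finset_cover_ball (Er r) hBβ
      (show 0 < 4 * e / (3 * t) by positivity)
    rw [finrank_continuousLinearMap_Er] at hcard₁ hcard₂
    rw [finrank_euclideanSpace_fin] at hcard₃
    refine ⟨S₁ ×ˢ S₂ ×ˢ S₃, ?_, ?_, ?_⟩
    · intro W₁' W₂' β' h
      simp only [Finset.mem_product] at h
      exact ⟨hS₁ _ h.1, hS₂ _ h.2.1, hS₃ _ h.2.2⟩
    · rw [Finset.card_product, Finset.card_product, Nat.cast_mul, Nat.cast_mul]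
      exact card_product_le he0 hA0 hte htK htA (Nat.cast_nonneg _) (Nat.cast_nonneg _)
        hcard₁ hcard₂ hcard₃
    · intro W₁ W₂ β hW₁ hW₂ hβ
      obtain ⟨W₁', hW₁S, hD₁⟩ := hcov₁ W₁ hW₁
      obtain ⟨W₂', hW₂S, hD₂⟩ := hcov₂ W₂ hW₂
      obtain ⟨β', hβS, hD₃⟩ := hcov₃ β hβ
      refine ⟨W₁', W₂', β', by simp [hW₁S, hW₂S, hβS], fun x hx => ?_⟩
      refine (abs_sigmoid_sub_le _ _).trans ?_
      have hdot := abs_sum_mul_sub_sum_mul_le β β' (treeEmb φ ρ g x W₁ W₂ L [])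
        (treeEmb φ ρ g x W₁' W₂' L [])
      have hβT := mul_le_mul hD₃ (hroot W₁ W₂ hW₁ hW₂ x hx) (norm_nonneg _) (by positivity)
      have hTT := norm_treeEmb_sub_le hCφ.le hCρ.le hCg.le hφ hρ hg hρ0 hB₂.le (hS₂ _ hW₂S) hD₁
        hD₂ hx (hbound W₁ W₂ hW₁ hW₂ x hx) L le_rfl []
      have hfirst : Cφ * (2 * e / A * B₁) * Bx * ∑ ℓ ∈ Finset.range (L + 1), (C * d) ^ ℓ =
          2 * e := by
        rw [show Cφ * (2 * e / A * B₁) * Bx * ∑ ℓ ∈ Finset.range (L + 1), (C * d) ^ ℓ =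
          2 * e / A * A by rw [hA]; ring]
        field_simp
      have hsecond : Cφ * (e / (3 * K) * B₂) * Rb * Q ≤ e / 3 := by
        calc Cφ * (e / (3 * K) * B₂) * Rb * Q = e / (3 * K) * (M * (Rb * B₂)) := by
              simp only [M]; ring
          _ ≤ e / (3 * K) * K := by gcongr
          _ = e / 3 := by field_simp
      have hthird : 4 * e / (3 * t) * Bβ * t = 4 / 3 * (Bβ * e) := by
        field_simp
      have hΔ : ‖treeEmb φ ρ g x W₁ W₂ L [] - treeEmb φ ρ g x W₁' W₂' L []‖ ≤ 2 * e + e / 3 :=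
        hTT.trans (add_le_add hfirst.le hsecond)
      have hβΔ := mul_le_mul (hS₃ _ hβS) hΔ (norm_nonneg _) hBβ.le
      rw [hthird] at hβT
      linarith
end

section
/- Let 𝒳 be a countable type and N ∈ ℕ. Then there exist functions f : 𝒳 → ℝ and g : ℕ → ℝ such that the map h sending each finite list (x₁,…,x_k) of elements of 𝒳 with k ≤ N to h(x₁,…,x_k) = Σ_{i=1}^k g(i)·f(x_i) is injective on the set of all lists over 𝒳 of length at most N; that is, if (x₁,…,x_k) and (x₁′,…,x_{k′}′) are lists of lengths k, k′ ≤ N with Σ_{i=1}^k g(i) f(x_i) = Σ_{i=1}^{k′} g(i) f(x_i′), then k = k′ and x_i = x_i′ for all i. -/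
open scoped BigOperators

open Polynomial in
/-- The polynomial whose coefficient at `i + 1` is the `i`-th entry of `l`. -/
noncomputable def portPolynomial {α : Type*} (e : α → ℤ) (l : List α) : ℤ[X] :=
  ∑ i : Fin l.length, C (e (l.get i)) * X ^ (i.1 + 1)

theorem coeff_portPolynomial {α : Type*} (e : α → ℤ) (l : List α) (n : ℕ) :
    (portPolynomial e l).coeff (n + 1) = (l[n]?.map e).getD 0 := by
  simp only [portPolynomial, Polynomial.finsetSum_coeff, Polynomial.coeff_C_mul_X_pow,
    add_left_inj]
  by_cases h : n < l.length
  · rw [Finset.sum_eq_single (⟨n, h⟩ : Fin l.length)]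
    · simp [h]
    · intro i _ hi
      exact if_neg fun hn => hi (Fin.ext hn.symm)
    · simp
  · rw [Finset.sum_eq_zero fun i _ => if_neg (by have := i.2; omega)]
    simp [List.getElem?_eq_none (not_lt.mp h)]

theorem portPolynomial_injective {α : Type*} {e : α → ℤ} (he : Function.Injective e)
    (h0 : ∀ x, e x ≠ 0) : Function.Injective (portPolynomial e) := by
  intro l₁ l₂ h
  refine List.ext_getElem? fun n => ?_
  have hn := congrArg (fun p => Polynomial.coeff p (n + 1)) h
  simp only [coeff_portPolynomial] at hn
  generalize l₁[n]? = a at hn ⊢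
  generalize l₂[n]? = b at hn ⊢
  rcases a with _ | x <;> rcases b with _ | y
  · rfl
  · exact absurd hn.symm (h0 y)
  · exact absurd hn (h0 x)
  · exact congrArg some (he hn)

theorem aeval_portPolynomial {α : Type*} (e : α → ℤ) (l : List α) (t : ℝ) :
    Polynomial.aeval t (portPolynomial e l) =
      ∑ i : Fin l.length, t ^ (i.1 + 1) * (e (l.get i) : ℝ) := by
  simp [portPolynomial, mul_comm]

/-- **Proposition 7 of the paper.** For a countable message space
`𝒳` and a bound `N`, there are functions `f : 𝒳 → ℝ` and `g : ℕ → ℝ` such that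
the sum form `(x₁,…,x_k) ↦ Σ_{i=1}^k g(i)·f(x_i)` is injective on lists over `𝒳`
of length at most `N`. -/
theorem exists_injective_sum_form_for_ports
    (𝒳 : Type) [Countable 𝒳] (N : ℕ) :
    ∃ (f : 𝒳 → ℝ) (g : ℕ → ℝ),
      ∀ l₁ l₂ : List 𝒳, l₁.length ≤ N → l₂.length ≤ N →
        (∑ i : Fin l₁.length, g (i.1 + 1) * f (l₁.get i)) =
          (∑ i : Fin l₂.length, g (i.1 + 1) * f (l₂.get i)) →
        l₁ = l₂ := by
  obtain ⟨c, hc⟩ := Countable.exists_injective_nat 𝒳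
  let e : 𝒳 → ℤ := fun x => (c x : ℤ) + 1
  have he : Function.Injective e := fun x y h => hc (by simpa [e] using h)
  have h0 : ∀ x, e x ≠ 0 := fun x => by simp only [e]; omega
  have ht : Transcendental ℤ (liouvilleNumber ((2 : ℕ) : ℝ)) :=
    transcendental_liouvilleNumber le_rfl
  refine ⟨fun x => e x, fun n => liouvilleNumber ((2 : ℕ) : ℝ) ^ n, fun l₁ l₂ _ _ h => ?_⟩
  rw [← aeval_portPolynomial, ← aeval_portPolynomial] at h
  exact portPolynomial_injective he h0 (transcendental_iff_injective.mp ht h)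
end
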